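/- arXiv:1608.06834 — 7 statements merged into one kernel-verified Lean document; each statement's English description precedes it below -/
import Mathlib

section
/- If n is an odd positive integer with I(n) = 7/3, then n is a perfect square, 9 divides n, and n has at least two distinct prime factors. -/
/-- An odd number whose sum of divisors is odd is a perfect square: otherwise `d ↦ n / d` pairs off
the divisors of `n`. -/
theorem Nat.isSquare_of_odd_of_odd_sigma_one {n : ℕ} (hn : Odd n)
    (hσ : Odd (ArithmeticFunction.sigma 1 n)) : IsSquare n := by
  by_contra hsq
  have hzero : ∑ d ∈ n.divisors, (d : ZMod 2) = 0 := by
    refine Finset.sum_involution (fun d _ ↦ n / d) ?_ ?_ ?_ ?_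
    · intro d hd
      have hdvd := Nat.dvd_of_mem_divisors hd
      rw [← Nat.cast_add, ZMod.natCast_eq_zero_iff_even]
      exact (hn.of_dvd_nat hdvd).add_odd (hn.of_dvd_nat (Nat.div_dvd_of_dvd hdvd))
    · intro d hd _ heq
      refine hsq ⟨d, ?_⟩
      have := Nat.div_mul_cancel (Nat.dvd_of_mem_divisors hd)
      rw [heq] at this
      exact this.symm
    · intro d hd
      exact Nat.mem_divisors.2
        ⟨Nat.div_dvd_of_dvd (Nat.dvd_of_mem_divisors hd), hn.pos.ne'⟩
    · intro d hd
      exact Nat.div_div_self (Nat.dvd_of_mem_divisors hd) hn.pos.ne'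
  rw [← Nat.cast_sum, ← ArithmeticFunction.sigma_one_apply,
    ZMod.natCast_eq_zero_iff_even] at hzero
  exact Nat.not_even_iff_odd.2 hσ hzero

theorem Nat.two_mul_sigma_one_three_pow_add_one (k : ℕ) :
    2 * ArithmeticFunction.sigma 1 (3 ^ k) + 1 = 3 * 3 ^ k := by
  rw [ArithmeticFunction.sigma_one_apply_prime_pow Nat.prime_three]
  have := mul_geom_sum (3 : ℤ) (k + 1)
  zify
  linear_combination this

/-- If `n` is an odd positive integer with abundancy index `I(n) = 7/3`,
then `n` is a perfect square, `9 ∣ n`, and `n` has at least two distinct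
prime factors. -/
theorem odd_abundancy_seven_thirds (n : ℕ) (hn : 0 < n) (hodd : Odd n)
    (h : (ArithmeticFunction.sigma 1 n : ℚ) / n = 7 / 3) :
    (∃ k : ℕ, n = k ^ 2) ∧ 9 ∣ n ∧ 2 ≤ n.primeFactors.card := by
  have hσ : 3 * ArithmeticFunction.sigma 1 n = 7 * n := by
    field_simp at h
    exact_mod_cast (by linarith : (3 : ℚ) * ArithmeticFunction.sigma 1 n = 7 * n)
  have h3 : 3 ∣ n := by lia
  have hσodd : Odd (ArithmeticFunction.sigma 1 n) := by
    obtain ⟨m, rfl⟩ := hodd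
    rw [Nat.odd_iff]
    lia
  obtain ⟨k, hk⟩ := Nat.isSquare_of_odd_of_odd_sigma_one hodd hσodd
  rw [← sq] at hk
  refine ⟨⟨k, hk⟩, ?_, ?_⟩
  · rw [hk] at h3 ⊢
    exact pow_dvd_pow_of_dvd (Nat.prime_three.dvd_of_dvd_pow h3) 2
  · by_contra! hcard
    have hpow := Nat.eq_prime_pow_of_unique_prime_dvd (p := 3) hn.ne' fun {d} hd hdn ↦
      Finset.card_le_one.1 (Nat.le_of_lt_succ hcard) d (Nat.mem_primeFactors.2 ⟨hd, hdn, hn.ne'⟩)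
        3 (Nat.mem_primeFactors.2 ⟨Nat.prime_three, h3, hn.ne'⟩)
    have hsum := Nat.two_mul_sigma_one_three_pow_add_one n.primeFactorsList.length
    rw [← hpow] at hsum
    lia
end

section
/- If n is an odd positive integer with I(n) = 7/3, then n = 3^{2a} · ∏_{i=1}^{k} p_i^{2e_i}, where p_1, …, p_k are distinct primes greater than 3, a, e_1, …, e_k are positive integers, and k ≥ 4. In particular, n is a perfect square with at least 5 distinct prime factors, one of which is 3. -/
open Finset in
lemma sigma_one_eq_prod {n : ℕ} (hn : n ≠ 0) :
    ArithmeticFunction.sigma 1 n =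
      ∏ p ∈ n.primeFactors, ∑ i ∈ range (n.factorization p + 1), p ^ i := by
  rw [ArithmeticFunction.isMultiplicative_sigma.multiplicative_factorization _ hn,
    Nat.prod_factorization_eq_prod_primeFactors]
  refine Finset.prod_congr rfl fun p hp => ?_
  rw [ArithmeticFunction.sigma_one_apply_prime_pow (Nat.prime_of_mem_primeFactors hp)]

open Finset in
/-- The abundancy index of the prime power `p ^ e`, as a geometric sum in `1 / p`. -/
def primePowAbundancy (p e : ℕ) : ℚ := ∑ i ∈ range (e + 1), (1 / (p : ℚ)) ^ i

lemma primePowAbundancy_nonneg (p e : ℕ) : 0 ≤ primePowAbundancy p e :=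
  Finset.sum_nonneg fun _ _ => by positivity

lemma primePowAbundancy_mono (p : ℕ) {e f : ℕ} (h : e ≤ f) :
    primePowAbundancy p e ≤ primePowAbundancy p f :=
  Finset.sum_le_sum_of_subset_of_nonneg (Finset.range_mono (by lia)) fun _ _ _ => by positivity

lemma primePowAbundancy_le {m p : ℕ} (hm : 2 ≤ m) (h : m ≤ p) (e : ℕ) :
    primePowAbundancy p e ≤ m / (m - 1) := by
  have hm' : (2 : ℚ) ≤ m := by exact_mod_cast hm
  have h' : (m : ℚ) ≤ p := by exact_mod_cast h
  have hx : 1 / (p : ℚ) < 1 := by rw [div_lt_one] <;> linarith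
  have hgeom : primePowAbundancy p e ≤ p / (p - 1) := by
    have hpow : 0 ≤ (1 / (p : ℚ)) ^ (e + 1) := by positivity
    have hmul := geom_sum_mul_neg (1 / (p : ℚ)) (e + 1)
    have hone : (p : ℚ) / (p - 1) * (1 - 1 / p) = 1 := by
      have : (p : ℚ) ≠ 0 := by linarith
      have : (p : ℚ) - 1 ≠ 0 := by linarith
      field_simp
    refine le_of_mul_le_mul_right ?_ (sub_pos.2 hx)
    rw [hone, primePowAbundancy, hmul]
    linarith
  refine hgeom.trans ?_
  rw [div_le_div_iff₀ (by linarith) (by linarith)]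
  linarith

open Finset in
lemma abundancy_eq_prod {n : ℕ} (hn : n ≠ 0) :
    (ArithmeticFunction.sigma 1 n : ℚ) / n =
      ∏ p ∈ n.primeFactors, primePowAbundancy p (n.factorization p) := by
  have hcast : (n : ℚ) = ∏ p ∈ n.primeFactors, (p : ℚ) ^ n.factorization p := by
    conv_lhs => rw [← Nat.prod_factorization_pow_eq_self hn]
    rw [Nat.prod_factorization_eq_prod_primeFactors]
    push_cast
    rfl
  rw [sigma_one_eq_prod hn]
  conv_lhs => rw [hcast]
  push_cast
  rw [← Finset.prod_div_distrib]
  refine Finset.prod_congr rfl fun p hp => ?_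
  have hp0 : (p : ℚ) ≠ 0 := by exact_mod_cast (Nat.prime_of_mem_primeFactors hp).ne_zero
  rw [primePowAbundancy, ← Finset.sum_range_reflect, Finset.sum_div]
  refine Finset.sum_congr rfl fun i hi => ?_
  have hi' : i ≤ n.factorization p := by simpa [Nat.lt_succ_iff] using hi
  rw [Nat.add_sub_cancel, one_div, inv_pow, div_eq_iff (pow_ne_zero _ hp0), inv_mul_eq_div,
    eq_div_iff (pow_ne_zero _ hp0), ← pow_add]
  congr 1
  lia

lemma prod_primePowAbundancy_le {U : Finset ℕ} {m k : ℕ} (e : ℕ → ℕ) (hm : 2 ≤ m)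
    (hU : ∀ p ∈ U, m ≤ p) (hk : U.card ≤ k) :
    ∏ p ∈ U, primePowAbundancy p (e p) ≤ ((m : ℚ) / (m - 1)) ^ k := by
  have hm' : (2 : ℚ) ≤ m := by exact_mod_cast hm
  calc ∏ p ∈ U, primePowAbundancy p (e p)
      ≤ ∏ _p ∈ U, ((m : ℚ) / (m - 1)) :=
        Finset.prod_le_prod (fun p _ => primePowAbundancy_nonneg p _)
          fun p hp => primePowAbundancy_le hm (hU p hp) _
    _ = ((m : ℚ) / (m - 1)) ^ U.card := Finset.prod_const _
    _ ≤ _ := pow_le_pow_right₀ (by rw [le_div_iff₀] <;> linarith) hk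

/-- A set of at most four odd primes containing `3` which supports an abundancy index of
at least `7 / 3` is `{3, 5, 7, 11}` or `{3, 5, 7, 13}`. -/
lemma eq_of_abundancy_ge {S : Finset ℕ} (e : ℕ → ℕ) (hprime : ∀ p ∈ S, p.Prime)
    (h2 : 2 ∉ S) (h3 : 3 ∈ S) (hcard : S.card ≤ 4)
    (h : 7 / 3 ≤ ∏ p ∈ S, primePowAbundancy p (e p)) :
    S = {3, 5, 7, 11} ∨ S = {3, 5, 7, 13} := by
  have hS : ∀ p ∈ S, p ≠ 3 → p = 5 ∨ p = 7 ∨ p = 11 ∨ p = 13 ∨ 17 ≤ p := by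
    intro p hp hp3
    by_contra! hne
    obtain ⟨h5, h7, h11, h13, h17⟩ := hne
    have := hprime p hp
    interval_cases p <;> contradiction
  have b3 := primePowAbundancy_le (m := 3) (p := 3) (by norm_num) le_rfl (e 3)
  have b5 := primePowAbundancy_le (m := 5) (p := 5) (by norm_num) le_rfl (e 5)
  have b7 := primePowAbundancy_le (m := 7) (p := 7) (by norm_num) le_rfl (e 7)
  rw [← Finset.mul_prod_erase S _ h3] at h
  have c3 := Finset.card_erase_of_mem h3
  set T := S.erase 3 with hT
  have hTmem : ∀ p ∈ T, p = 5 ∨ p = 7 ∨ p = 11 ∨ p = 13 ∨ 17 ≤ p := fun p hp =>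
    hS p (Finset.mem_of_mem_erase hp) (Finset.ne_of_mem_erase hp)
  have nonneg (U : Finset ℕ) : 0 ≤ ∏ p ∈ U, primePowAbundancy p (e p) :=
    Finset.prod_nonneg fun p _ => primePowAbundancy_nonneg p _
  have T_le : 14 / 9 ≤ ∏ p ∈ T, primePowAbundancy p (e p) := by
    have := mul_le_mul_of_nonneg_right b3 (nonneg T)
    norm_num at this
    linarith
  have h5 : 5 ∈ T := by
    by_contra h5
    by_cases h7 : 7 ∈ T
    · rw [← Finset.mul_prod_erase T _ h7] at T_le
      have c7 := Finset.card_erase_of_mem h7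
      have := prod_primePowAbundancy_le (U := T.erase 7) (m := 11) (k := 2) e (by norm_num)
        (fun p hp => by
          have := hTmem p (Finset.mem_of_mem_erase hp)
          have : p ≠ 5 := fun h => h5 (h ▸ Finset.mem_of_mem_erase hp)
          have := Finset.ne_of_mem_erase hp
          lia) (by lia)
      have := mul_le_mul b7 this (nonneg _) (by norm_num)
      norm_num at this
      linarith
    · have := prod_primePowAbundancy_le (U := T) (m := 11) (k := 3) e (by norm_num)
        (fun p hp => by
          have := hTmem p hp
          have : p ≠ 5 := fun h => h5 (h ▸ hp)
          have : p ≠ 7 := fun h => h7 (h ▸ hp)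
          lia) (by lia)
      norm_num at this
      linarith
  rw [← Finset.mul_prod_erase T _ h5] at T_le
  have c5 := Finset.card_erase_of_mem h5
  set U := T.erase 5 with hU
  have hUmem : ∀ p ∈ U, p = 7 ∨ p = 11 ∨ p = 13 ∨ 17 ≤ p := fun p hp => by
    have := hTmem p (Finset.mem_of_mem_erase hp)
    have := Finset.ne_of_mem_erase hp
    lia
  have U_le : 56 / 45 ≤ ∏ p ∈ U, primePowAbundancy p (e p) := by
    have := mul_le_mul_of_nonneg_right b5 (nonneg U)
    norm_num at this
    linarith
  have h7 : 7 ∈ U := by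
    by_contra h7
    have := prod_primePowAbundancy_le (U := U) (m := 11) (k := 2) e (by norm_num)
      (fun p hp => by
        have := hUmem p hp
        have : p ≠ 7 := fun h => h7 (h ▸ hp)
        lia) (by lia)
    norm_num at this
    linarith
  rw [← Finset.mul_prod_erase U _ h7] at U_le
  have c7 := Finset.card_erase_of_mem h7
  set V := U.erase 7 with hV
  have hVmem : ∀ p ∈ V, p = 11 ∨ p = 13 ∨ 17 ≤ p := fun p hp => by
    have := hUmem p (Finset.mem_of_mem_erase hp)
    have := Finset.ne_of_mem_erase hp
    lia
  have hSV : S = insert 3 (insert 5 (insert 7 V)) := by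
    rw [hV, Finset.insert_erase h7, hU, Finset.insert_erase h5, hT, Finset.insert_erase h3]
  have hV1 : V.card ≤ 1 := by lia
  have hr : 11 ∈ V ∨ 13 ∈ V := by
    by_contra! hr
    have := prod_primePowAbundancy_le (U := V) (m := 17) (k := 1) e (by norm_num)
      (fun p hp => by
        have := hVmem p hp
        have : p ≠ 11 := fun h => hr.1 (h ▸ hp)
        have : p ≠ 13 := fun h => hr.2 (h ▸ hp)
        lia) hV1
    have := mul_le_mul b7 this (nonneg _) (by norm_num)
    norm_num at this
    linarith
  rw [hSV]
  refine hr.imp (fun hr => ?_) (fun hr => ?_) <;>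
  · rw [Finset.eq_singleton_iff_unique_mem.2
      ⟨hr, fun x hx => Finset.card_le_one.1 hV1 x hx _ hr⟩]

/-- On the supports `{3, 5, 7, 11}` and `{3, 5, 7, 13}` the abundancy index `7 / 3` is overshot
once the exponent of `3` is at least `4`, and is not reached if that exponent is at most `2`. -/
lemma primePowAbundancy_mul_ne {r a b c d : ℕ} (hr : r = 11 ∨ r = 13) (ha : a ≤ 2 ∨ 4 ≤ a)
    (hb : 4 ≤ b) (hc : 2 ≤ c) (hd : 2 ≤ d) :
    primePowAbundancy 3 a * (primePowAbundancy 5 b *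
      (primePowAbundancy 7 c * primePowAbundancy r d)) ≠ 7 / 3 := by
  have nonneg := primePowAbundancy_nonneg
  rcases ha with ha | ha
  · have b3 := primePowAbundancy_mono 3 ha
    have b5 := primePowAbundancy_le (m := 5) (p := 5) (by norm_num) le_rfl b
    have b7 := primePowAbundancy_le (m := 7) (p := 7) (by norm_num) le_rfl c
    have br := primePowAbundancy_le (m := 11) (p := r) (by norm_num) (by lia) d
    have key := mul_le_mul b3 (mul_le_mul b5 (mul_le_mul b7 br (nonneg _ _) (by norm_num))
      (mul_nonneg (nonneg _ _) (nonneg _ _)) (by norm_num))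
      (mul_nonneg (nonneg _ _) (mul_nonneg (nonneg _ _) (nonneg _ _))) (nonneg _ _)
    refine (key.trans_lt ?_).ne
    norm_num [primePowAbundancy, Finset.sum_range_succ]
  · have key := mul_le_mul (primePowAbundancy_mono 3 ha) (mul_le_mul (primePowAbundancy_mono 5 hb)
      (mul_le_mul (primePowAbundancy_mono 7 hc) (primePowAbundancy_mono r hd)
        (nonneg _ _) (nonneg _ _))
      (mul_nonneg (nonneg _ _) (nonneg _ _)) (nonneg _ _))
      (mul_nonneg (nonneg _ _) (mul_nonneg (nonneg _ _) (nonneg _ _))) (nonneg _ _)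
    refine (lt_of_lt_of_le ?_ key).ne'
    rcases hr with rfl | rfl <;> norm_num [primePowAbundancy, Finset.sum_range_succ]

open Finset in
lemma even_factorization_of_odd_sigma {n : ℕ} (hodd : Odd n)
    (hσ : Odd (ArithmeticFunction.sigma 1 n)) (p : ℕ) : Even (n.factorization p) := by
  by_cases hp : p ∈ n.primeFactors
  · rw [sigma_one_eq_prod hodd.pos.ne'] at hσ
    have hsum := hσ.of_dvd_nat (dvd_prod_of_mem _ hp)
    have hp_odd : Odd p := hodd.of_dvd_nat (Nat.dvd_of_mem_primeFactors hp)
    rw [odd_sum_iff_odd_card_odd, filter_true_of_mem fun i _ => hp_odd.pow, card_range] at hsum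
    simpa [Nat.odd_add_one] using hsum
  · rw [Finsupp.notMem_support_iff.1 (by simpa using hp)]
    exact Even.zero

open Finset in
lemma five_le_card_primeFactors {n : ℕ} (hodd : Odd n)
    (h : 3 * ArithmeticFunction.sigma 1 n = 7 * n)
    (heven : ∀ p, Even (n.factorization p)) (h3 : 3 ∈ n.primeFactors) :
    5 ≤ n.primeFactors.card := by
  have hn : n ≠ 0 := hodd.pos.ne'
  have hprod : ∏ p ∈ n.primeFactors, primePowAbundancy p (n.factorization p) = 7 / 3 := by
    have hn' : (n : ℚ) ≠ 0 := by exact_mod_cast hn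
    rw [← abundancy_eq_prod hn, div_eq_div_iff hn' (by norm_num), mul_comm]
    exact_mod_cast h
  by_contra! hcard
  have h2 : 2 ∉ n.primeFactors := fun h2 =>
    (Nat.not_even_iff_odd.2 hodd) (even_iff_two_dvd.2 (Nat.dvd_of_mem_primeFactors h2))
  obtain ⟨r, hr, hS⟩ : ∃ r, (r = 11 ∨ r = 13) ∧ n.primeFactors = {3, 5, 7, r} := by
    rcases eq_of_abundancy_ge _ (fun p => Nat.prime_of_mem_primeFactors) h2 h3 (by lia)
      hprod.ge with hS | hS
    exacts [⟨11, .inl rfl, hS⟩, ⟨13, .inr rfl, hS⟩]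
  have two_le : ∀ p ∈ n.primeFactors, 2 ≤ n.factorization p := fun p hp => by
    have := (Nat.prime_of_mem_primeFactors hp).factorization_pos_of_dvd hn
      (Nat.dvd_of_mem_primeFactors hp)
    obtain ⟨k, hk⟩ := heven p
    lia
  have h5 : 5 ∈ n.primeFactors := by simp [hS]
  have h7 : 7 ∈ n.primeFactors := by simp [hS]
  have hrS : r ∈ n.primeFactors := by simp [hS]
  have hv5 : n.factorization 5 ≠ 2 := fun hv => by
    have hdvd : 31 ∣ ArithmeticFunction.sigma 1 n := by
      rw [sigma_one_eq_prod hn]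
      refine dvd_trans ?_ (dvd_prod_of_mem _ h5)
      rw [hv]
      decide
    have h31 : 31 ∣ n := by lia
    have : 31 ∈ n.primeFactors := Nat.mem_primeFactors.2 ⟨by norm_num, h31, hn⟩
    rw [hS] at this
    simp only [mem_insert, mem_singleton] at this
    lia
  obtain ⟨a, ha⟩ := heven 3
  obtain ⟨b, hb⟩ := heven 5
  have := two_le 5 h5
  refine primePowAbundancy_mul_ne hr (a := n.factorization 3) (by lia) (b := n.factorization 5)
    (by lia) (two_le 7 h7) (two_le r hrS) ?_
  rw [← hprod]
  conv_rhs => rw [hS]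
  rw [prod_insert, prod_insert, prod_insert, prod_singleton] <;>
    simp only [mem_insert, mem_singleton] <;> lia


/-- If `n` is an odd positive integer with abundancy index `7/3`, then
`n = 3^(2a) * ∏ i, p i ^ (2 * e i)` where the `p i` are distinct primes
greater than `3`, `a` and the `e i` are positive, and `k ≥ 4`.  In
particular `n` is a perfect square with at least 5 distinct prime factors,
one of which is `3`. -/
theorem odd_friend_of_twelve_form (n : ℕ) (hn : 0 < n) (hodd : Odd n)
    (h : (ArithmeticFunction.sigma 1 n : ℚ) / n = 7 / 3) :
    (∃ (a k : ℕ) (p e : Fin k → ℕ),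
      0 < a ∧ 4 ≤ k ∧ Function.Injective p ∧
      (∀ i, (p i).Prime ∧ 3 < p i ∧ 0 < e i) ∧
      n = 3 ^ (2 * a) * ∏ i, p i ^ (2 * e i)) ∧
    (∃ m : ℕ, n = m ^ 2) ∧ 5 ≤ n.primeFactors.card ∧ 3 ∈ n.primeFactors := by
  have hn0 : n ≠ 0 := hn.ne'
  have hσ : 3 * ArithmeticFunction.sigma 1 n = 7 * n := by
    rw [div_eq_div_iff (by exact_mod_cast hn0) (by norm_num), mul_comm] at h
    exact_mod_cast h
  have heven := even_factorization_of_odd_sigma hodd (by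
    obtain ⟨k, hk⟩ := hodd
    rw [Nat.odd_iff]
    lia)
  have h3 : 3 ∈ n.primeFactors := Nat.mem_primeFactors.2 ⟨Nat.prime_three, by lia, hn0⟩
  have hcard := five_le_card_primeFactors hodd hσ heven h3
  have half (p : ℕ) : 2 * (n.factorization p / 2) = n.factorization p :=
    Nat.two_mul_div_two_of_even (heven p)
  have half_pos : ∀ p ∈ n.primeFactors, 0 < n.factorization p / 2 := fun p hp => by
    have := (Nat.prime_of_mem_primeFactors hp).factorization_pos_of_dvd hn0
      (Nat.dvd_of_mem_primeFactors hp)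
    have := half p
    lia
  have hfact : n = ∏ p ∈ n.primeFactors, p ^ (2 * (n.factorization p / 2)) := by
    simp only [half]
    conv_lhs => rw [← Nat.prod_factorization_pow_eq_self hn0]
    exact Nat.prod_factorization_eq_prod_primeFactors _
  refine ⟨⟨n.factorization 3 / 2, (n.primeFactors.erase 3).card,
    fun i => (n.primeFactors.erase 3).equivFin.symm i,
    fun i => n.factorization ((n.primeFactors.erase 3).equivFin.symm i) / 2,
    half_pos 3 h3, ?_, Subtype.val_injective.comp (Equiv.injective _), fun i => ?_, ?_⟩,
    ⟨∏ p ∈ n.primeFactors, p ^ (n.factorization p / 2), ?_⟩, hcard, h3⟩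
  · rw [Finset.card_erase_of_mem h3]
    lia
  · obtain ⟨hne, hmem⟩ := Finset.mem_erase.1 ((n.primeFactors.erase 3).equivFin.symm i).2
    have hp := Nat.prime_of_mem_primeFactors hmem
    have hp_odd := hodd.of_dvd_nat (Nat.dvd_of_mem_primeFactors hmem)
    refine ⟨hp, ?_, half_pos _ hmem⟩
    have := hp.two_le
    rw [Nat.odd_iff] at hp_odd
    lia
  · rw [Equiv.prod_comp (n.primeFactors.erase 3).equivFin.symm
      (fun p => (p : ℕ) ^ (2 * (n.factorization p / 2))),
      Finset.prod_coe_sort (n.primeFactors.erase 3)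
        (fun p => p ^ (2 * (n.factorization p / 2))),
      Finset.mul_prod_erase _ (fun p => p ^ (2 * (n.factorization p / 2))) h3]
    exact hfact
  · rw [← Finset.prod_pow]
    simpa only [← pow_mul, mul_comm 2] using hfact
end

section
/- If n is an odd positive integer with I(n) = 7/3, then n has at least 5 distinct prime factors. -/
/-- A finite set of odd numbers in `[3, a)`, with `a` odd, has at most `(a - 3) / 2` elements. -/
theorem two_mul_card_add_three_le_of_odd (T : Finset ℕ) : ∀ a : ℕ, Odd a → 3 ≤ a →
    (∀ x ∈ T, Odd x ∧ 3 ≤ x ∧ x < a) → 2 * T.card + 3 ≤ a := by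
  induction T using Finset.induction_on_max with
  | empty => intro a _ h _; simpa using h
  | insert b s hb ih =>
    intro a ha _ hT
    have hbs : b ∉ s := fun h => lt_irrefl _ (hb b h)
    obtain ⟨hbo, hb3, hba⟩ := hT b (Finset.mem_insert_self b s)
    have hs := ih b hbo hb3 fun x hx =>
      ⟨(hT x (Finset.mem_insert_of_mem hx)).1, (hT x (Finset.mem_insert_of_mem hx)).2.1, hb x hx⟩
    rw [Finset.card_insert_of_notMem hbs]
    obtain ⟨k, rfl⟩ := ha
    obtain ⟨l, rfl⟩ := hbo
    omega

theorem div_sub_one_le_div_sub_one {m p : ℚ} (hm : 1 < m) (h : m ≤ p) :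
    p / (p - 1) ≤ m / (m - 1) := by
  rw [div_le_div_iff₀ (by linarith) (by linarith)]
  linarith

/-- Among finite sets of odd numbers `≥ 3` of a given size, the product of `p / (p - 1)` is
largest for the initial segment `3, 5, 7, …`. -/
theorem prod_div_sub_one_le_of_odd (T : Finset ℕ) (hT : ∀ x ∈ T, Odd x ∧ 3 ≤ x) :
    ∏ p ∈ T, (p : ℚ) / (p - 1) ≤
      ∏ i ∈ Finset.range T.card, (2 * i + 3 : ℚ) / (2 * i + 3 - 1) := by
  induction T using Finset.induction_on_max with
  | empty => simp
  | insert b s hb ih =>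
    have hbs : b ∉ s := fun h => lt_irrefl _ (hb b h)
    obtain ⟨hbo, hb3⟩ := hT b (Finset.mem_insert_self b s)
    have hs : ∀ x ∈ s, Odd x ∧ 3 ≤ x := fun x hx => hT x (Finset.mem_insert_of_mem hx)
    have hcard := two_mul_card_add_three_le_of_odd s b hbo hb3 fun x hx =>
      ⟨(hs x hx).1, (hs x hx).2, hb x hx⟩
    rw [Finset.card_insert_of_notMem hbs, Finset.prod_insert hbs, Finset.prod_range_succ, mul_comm]
    have hcard' : (2 * s.card + 3 : ℚ) ≤ b := by exact_mod_cast hcard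
    have hb' : (3 : ℚ) ≤ b := by exact_mod_cast hb3
    refine mul_le_mul (ih hs) (div_sub_one_le_div_sub_one ?_ hcard') ?_ ?_
    · have : (0 : ℚ) ≤ s.card := Nat.cast_nonneg _
      linarith
    · exact div_nonneg (by linarith) (by linarith)
    · refine Finset.prod_nonneg fun i _ => div_nonneg (by positivity) ?_
      have : (0 : ℚ) ≤ i := Nat.cast_nonneg _
      linarith

theorem prod_div_sub_one_le_of_card_le_three (T : Finset ℕ) (hT : ∀ x ∈ T, Odd x ∧ 3 ≤ x)
    (hc : T.card ≤ 3) : ∏ p ∈ T, (p : ℚ) / (p - 1) ≤ 35 / 16 := by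
  refine (prod_div_sub_one_le_of_odd T hT).trans ?_
  interval_cases T.card <;> norm_num [Finset.prod_range_succ]

theorem sigma_one_div_self_le_prod {n : ℕ} (hn : n ≠ 0) :
    (ArithmeticFunction.sigma 1 n : ℚ) / n ≤ ∏ p ∈ n.primeFactors, (p : ℚ) / (p - 1) := by
  have hσ : ArithmeticFunction.sigma 1 n =
      ∏ p ∈ n.primeFactors, ArithmeticFunction.sigma 1 (p ^ n.factorization p) :=
    ArithmeticFunction.isMultiplicative_sigma.multiplicative_factorization _ hn
  have hprod : (n : ℚ) = ∏ p ∈ n.primeFactors, (p : ℚ) ^ n.factorization p := by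
    exact_mod_cast (Nat.prod_factorization_pow_eq_self hn).symm
  rw [hσ, hprod, Nat.cast_prod, ← Finset.prod_div_distrib]
  refine Finset.prod_le_prod (fun _ _ => by positivity) fun p hp => ?_
  have hpp := Nat.prime_of_mem_primeFactors hp
  have hp1 : (1 : ℚ) < p := by exact_mod_cast hpp.one_lt
  rw [ArithmeticFunction.sigma_one_apply_prime_pow hpp]
  push_cast
  rw [geom_sum_eq hp1.ne', div_div, div_le_div_iff₀ (by have := sub_pos.2 hp1; positivity)
    (by linarith)]
  have := sub_pos.2 hp1
  rw [pow_succ]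
  nlinarith [pow_pos (zero_lt_one.trans hp1) (n.factorization p)]

theorem primeFactors_of_card_le_four {n : ℕ} (hn : n ≠ 0) (hodd : Odd n)
    (h : (ArithmeticFunction.sigma 1 n : ℚ) / n = 7 / 3) (hc : n.primeFactors.card ≤ 4) :
    5 ∈ n.primeFactors ∧ n.primeFactors ⊆ {3, 5, 7, 11, 13} := by
  have hle := sigma_one_div_self_le_prod hn
  rw [h] at hle
  have hS : ∀ x ∈ n.primeFactors, Odd x ∧ 3 ≤ x := fun x hx => by
    have hxo : Odd x := hodd.of_dvd_nat (Nat.dvd_of_mem_primeFactors hx)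
    have := (Nat.prime_of_mem_primeFactors hx).two_le
    obtain ⟨k, rfl⟩ := hxo
    exact ⟨⟨k, rfl⟩, by omega⟩
  have hsub : n.primeFactors ⊆ {3, 5, 7, 11, 13} := by
    intro p hp
    by_contra hpS
    have hpp := Nat.prime_of_mem_primeFactors hp
    have h17 : 17 ≤ p := by
      by_contra! hlt
      obtain ⟨ho, h3⟩ := hS p hp
      interval_cases p <;> revert hpS hpp ho <;> decide
    have h17' : (17 : ℚ) ≤ p := by exact_mod_cast h17
    rw [← Finset.mul_prod_erase _ _ hp] at hle
    have h1 := prod_div_sub_one_le_of_card_le_three (n.primeFactors.erase p)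
      (fun x hx => hS x (Finset.mem_of_mem_erase hx))
      (by rw [Finset.card_erase_of_mem hp]; omega)
    have h2 := div_sub_one_le_div_sub_one (by norm_num) h17'
    have := hle.trans (mul_le_mul_of_nonneg_left h1 (div_nonneg (by linarith) (by linarith)))
    norm_num at h2
    linarith
  refine ⟨?_, hsub⟩
  by_contra h5
  have hsub' : n.primeFactors ⊆ {3, 7, 11, 13} := fun p hp => by
    have := hsub hp
    have : p ≠ 5 := fun h => h5 (h ▸ hp)
    simp_all
  have := hle.trans (Finset.prod_le_prod_of_subset_of_one_le
    (f := fun p : ℕ => (p : ℚ) / (p - 1)) hsub' (fun p hp => ?_) (fun p hp _ => ?_))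
  · norm_num at this
  · have h3 : (3 : ℚ) ≤ p := by exact_mod_cast (hS p hp).2
    exact div_nonneg (by linarith) (by linarith)
  · simp only [Finset.mem_insert, Finset.mem_singleton] at hp
    rcases hp with rfl | rfl | rfl | rfl <;> norm_num

theorem geom_sum_five_induction {P : ℕ → Prop} (one : P 1) (step : ∀ s, P s → P (25 * s + 6))
    (k : ℕ) : P (∑ i ∈ Finset.range (2 * k + 1), 5 ^ i) := by
  induction k with
  | zero => simpa using one
  | succ k ih =>
    convert step _ ih using 1
    rw [show 2 * (k + 1) + 1 = 2 * k + 1 + 1 + 1 by ring, Finset.sum_range_succ',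
      Finset.sum_range_succ', Finset.mul_sum]
    simp only [pow_succ, pow_zero, mul_assoc, mul_comm 25]
    norm_num [add_assoc]

/-- A prime factor of `1 + 5 + ⋯ + 5 ^ (2 * k)` cannot be `3`, `5`, `7` or `13`, and if it
is `11`, then `71` is a prime factor too. -/
theorem geom_sum_five_mod (k : ℕ) :
    (∑ i ∈ Finset.range (2 * k + 1), 5 ^ i) % 3 ≠ 0 ∧
    (∑ i ∈ Finset.range (2 * k + 1), 5 ^ i) % 5 ≠ 0 ∧
    (∑ i ∈ Finset.range (2 * k + 1), 5 ^ i) % 7 ≠ 0 ∧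
    (∑ i ∈ Finset.range (2 * k + 1), 5 ^ i) % 13 ≠ 0 ∧
    ((∑ i ∈ Finset.range (2 * k + 1), 5 ^ i) % 11 = 0 →
      (∑ i ∈ Finset.range (2 * k + 1), 5 ^ i) % 71 = 0) := by
  refine ⟨?_, ?_, ?_, ?_, ?_⟩
  · have := geom_sum_five_induction (P := fun s => s % 3 = 1) rfl (fun s _ => by omega) k
    omega
  · have := geom_sum_five_induction (P := fun s => s % 5 = 1) rfl (fun s _ => by omega) k
    omega
  · have := geom_sum_five_induction (P := fun s => s % 7 = 1 ∨ s % 7 = 3 ∨ s % 7 = 4)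
      (by norm_num) (fun s _ => by omega) k
    omega
  · have := geom_sum_five_induction (P := fun s => s % 13 = 1 ∨ s % 13 = 5)
      (by norm_num) (fun s _ => by omega) k
    omega
  · have := geom_sum_five_induction (P := fun s => s % 781 = 1 ∨ s % 781 = 31 ∨ s % 781 = 0 ∨
      s % 781 = 6 ∨ s % 781 = 156) (by norm_num)
      (fun s h => by rcases h with h | h | h | h | h <;> omega) k
    generalize ∑ i ∈ Finset.range (2 * k + 1), 5 ^ i = s at this
    rcases this with h | h | h | h | h <;> omega

/-- If `n` is an odd positive integer with abundancy index `7/3`, then `n`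
has at least 5 distinct prime factors. -/
theorem odd_friend_of_twelve_primeFactors (n : ℕ) (hn : 0 < n) (hodd : Odd n)
    (h : (ArithmeticFunction.sigma 1 n : ℚ) / n = 7 / 3) :
    5 ≤ n.primeFactors.card := by
  by_contra! hc
  obtain ⟨h5, hsub⟩ := primeFactors_of_card_le_four hn.ne' hodd h (by omega)
  have hσ : 3 * ArithmeticFunction.sigma 1 n = 7 * n := by
    have hn' : (n : ℚ) ≠ 0 := by exact_mod_cast hn.ne'
    rw [div_eq_div_iff hn' (by norm_num)] at h
    have : (3 * ArithmeticFunction.sigma 1 n : ℚ) = 7 * n := by linarith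
    exact_mod_cast this
  set e := n.factorization 5 with he
  have hfive : ∑ i ∈ Finset.range (e + 1), 5 ^ i ∣ ArithmeticFunction.sigma 1 n := by
    rw [ArithmeticFunction.isMultiplicative_sigma.multiplicative_factorization _ hn.ne',
      ← ArithmeticFunction.sigma_one_apply_prime_pow Nat.prime_five]
    exact Finset.dvd_prod_of_mem
      (fun p => ArithmeticFunction.sigma 1 (p ^ n.factorization p)) h5
  have hdvd : ∑ i ∈ Finset.range (e + 1), 5 ^ i ∣ 7 * n := hσ ▸ hfive.mul_left 3
  have hmem {q : ℕ} (hq : q.Prime) (h : q ∣ ∑ i ∈ Finset.range (e + 1), 5 ^ i) :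
      q ∈ ({3, 5, 7, 11, 13} : Finset ℕ) := by
    rcases hq.dvd_mul.1 (h.trans hdvd) with h7 | h7
    · rw [(Nat.prime_dvd_prime_iff_eq hq (by norm_num)).1 h7]
      decide
    · exact hsub (Nat.mem_primeFactors.2 ⟨hq, h7, hn.ne'⟩)
  have he0 : 0 < e := (Nat.prime_five.factorization_pos_of_dvd hn.ne'
    (Nat.dvd_of_mem_primeFactors h5))
  have heven : Even e := by
    have ho : Odd (∑ i ∈ Finset.range (e + 1), 5 ^ i) :=
      ((by decide : Odd 7).mul hodd).of_dvd_nat hdvd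
    rw [Finset.odd_sum_iff_odd_card_odd, Finset.filter_true_of_mem
      (fun i _ => (by decide : Odd 5).pow), Finset.card_range] at ho
    simpa [parity_simps] using ho
  obtain ⟨k, hk⟩ := heven.two_dvd
  rw [hk] at hmem
  obtain ⟨q, hq, hqd⟩ := Nat.exists_prime_and_dvd
    (n := ∑ i ∈ Finset.range (2 * k + 1), 5 ^ i) (by
      rw [Finset.sum_range_succ']
      have : 0 < ∑ i ∈ Finset.range (2 * k), 5 ^ (i + 1) :=
        Finset.sum_pos (fun _ _ => by positivity) ⟨0, by simp; omega⟩
      simp only [pow_zero]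
      omega)
  obtain ⟨h3, h5, h7, h13, h11⟩ := geom_sum_five_mod k
  have hq' := hmem hq hqd
  simp only [Finset.mem_insert, Finset.mem_singleton] at hq'
  rcases hq' with rfl | rfl | rfl | rfl | rfl
  · exact h3 (Nat.mod_eq_zero_of_dvd hqd)
  · exact h5 (Nat.mod_eq_zero_of_dvd hqd)
  · exact h7 (Nat.mod_eq_zero_of_dvd hqd)
  · exact absurd (hmem (by norm_num) (Nat.dvd_of_mod_eq_zero (h11 (Nat.mod_eq_zero_of_dvd hqd))))
      (by decide)
  · exact h13 (Nat.mod_eq_zero_of_dvd hqd)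
end

section
/- If n is an even positive integer with I(n) = 7/3 and n ≠ 234, then every prime divisor of n other than 2 and 3 is greater than or equal to 29. -/
open ArithmeticFunction in
/-- The abundancy index is strictly monotone with respect to proper divisibility, in
cross-multiplied form. -/
theorem sigma_one_mul_lt_of_dvd {d n : ℕ} (hn : 0 < n) (hdn : d ∣ n) (hne : d ≠ n) :
    sigma 1 d * n < sigma 1 n * d := by
  obtain ⟨k, rfl⟩ := hdn
  have hk : 0 < k := Nat.pos_of_mul_pos_left hn
  have hd : 0 < d := Nat.pos_of_mul_pos_right hn
  have hk1 : k ≠ 1 := by rintro rfl; simp at hne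
  have hlt : k * sigma 1 d < sigma 1 (d * k) := by
    rw [sigma_one_apply, sigma_one_apply, Finset.mul_sum,
      ← Finset.sum_image (f := fun x : ℕ => x) (g := fun x => k * x)
        (fun a _ b _ hab => Nat.eq_of_mul_eq_mul_left hk hab)]
    refine Finset.sum_lt_sum_of_subset (i := 1) (fun x hx => ?_)
      (Nat.one_mem_divisors.mpr hn.ne') (fun h => ?_) one_pos fun _ _ _ => Nat.zero_le _
    · obtain ⟨e, he, rfl⟩ := Finset.mem_image.mp hx
      refine Nat.mem_divisors.mpr ⟨?_, hn.ne'⟩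
      rw [mul_comm d]
      exact mul_dvd_mul_left k (Nat.dvd_of_mem_divisors he)
    · obtain ⟨e, -, he⟩ := Finset.mem_image.mp h
      exact hk1 (Nat.eq_one_of_mul_eq_one_right he)
  nlinarith

open ArithmeticFunction in
/-- The abundancy index is monotone with respect to divisibility, in cross-multiplied form. -/
theorem sigma_one_mul_le_of_dvd {d n : ℕ} (hn : 0 < n) (hdn : d ∣ n) :
    sigma 1 d * n ≤ sigma 1 n * d := by
  rcases eq_or_ne d n with rfl | hne
  · exact le_rfl
  · exact (sigma_one_mul_lt_of_dvd hn hdn hne).le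

open ArithmeticFunction in
/-- An even number of abundancy index `7/3` other than `12` and `234` is divisible by `2 * 3 ^ 6`. -/
theorem two_mul_three_pow_six_dvd {n : ℕ} (hn : 0 < n) (heven : Even n)
    (h : 3 * sigma 1 n = 7 * n) (h12 : n ≠ 12) (h234 : n ≠ 234) : 2 * 3 ^ 6 ∣ n := by
  have not_twelve_dvd : ¬ 12 ∣ n := fun hd => by
    have := sigma_one_mul_lt_of_dvd hn hd h12.symm
    rw [show sigma 1 12 = 28 by decide] at this
    omega
  have not_234_dvd : ¬ 234 ∣ n := fun hd => by
    have := sigma_one_mul_lt_of_dvd hn hd h234.symm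
    rw [show sigma 1 234 = 546 by decide +kernel] at this
    omega
  obtain ⟨u, rfl⟩ := heven.two_dvd
  have hu : ¬ 2 ∣ u := by omega
  rw [isMultiplicative_sigma.map_mul_of_coprime
    ((Nat.Prime.coprime_iff_not_dvd Nat.prime_two).mpr hu), show sigma 1 2 = 3 by decide] at h
  obtain ⟨a, k, hk, rfl⟩ := Nat.exists_eq_pow_mul_and_not_dvd (n := u) (by omega) 3 (by norm_num)
  have ha : 1 < a := by
    by_contra! ha
    interval_cases a <;> omega
  rw [isMultiplicative_sigma.map_mul_of_coprime
    (Nat.Coprime.pow_left a ((Nat.Prime.coprime_iff_not_dvd Nat.prime_three).mpr hk))] at h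
  by_cases ha6 : 6 ≤ a
  · exact mul_dvd_mul_left 2 ((pow_dvd_pow 3 ha6).mul_right k)
  have ha' : a < 6 := by omega
  interval_cases a
  · rw [show sigma 1 (3 ^ 2) = 13 by decide +kernel] at h
    omega
  · rw [show sigma 1 (3 ^ 3) = 40 by decide +kernel] at h
    omega
  · rw [show sigma 1 (3 ^ 4) = 121 by decide +kernel] at h
    have hk0 : 0 < k := Nat.pos_of_ne_zero fun hk0 => hk (hk0 ▸ dvd_zero 3)
    have hdvd : 121 ∣ k :=
      Nat.Coprime.dvd_of_dvd_mul_left (m := 1134) (by norm_num)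
        ⟨9 * sigma 1 k, by linarith only [h]⟩
    have hle := sigma_one_mul_le_of_dvd hk0 hdvd
    rw [show sigma 1 121 = 133 by decide +kernel] at hle
    linarith only [h, hle, hk0]
  · rw [show sigma 1 (3 ^ 5) = 364 by decide +kernel] at h
    omega

/-- If `n` is an even positive integer with abundancy index `7/3` and
`n ≠ 234`, then every prime divisor of `n` other than `2` and `3` is at
least `29`. -/
theorem even_friend_of_twelve_prime_bound (n : ℕ) (hn : 0 < n)
    (heven : Even n) (h : (ArithmeticFunction.sigma 1 n : ℚ) / n = 7 / 3)
    (hne : n ≠ 234) :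
    ∀ p : ℕ, p.Prime → p ∣ n → p ≠ 2 → p ≠ 3 → 29 ≤ p := by
  intro p hp hpn hp2 hp3
  have hσ : 3 * ArithmeticFunction.sigma 1 n = 7 * n := by
    rw [div_eq_div_iff (by positivity) (by norm_num)] at h
    rw [mul_comm]
    exact_mod_cast h
  have hpc2 : Nat.Coprime 2 p := (Nat.coprime_primes Nat.prime_two hp).mpr hp2.symm
  have hpc3 : Nat.Coprime 3 p := (Nat.coprime_primes Nat.prime_three hp).mpr hp3.symm
  by_cases h12 : n = 12
  · subst h12
    rcases (Nat.Prime.dvd_mul hp).mp (show p ∣ 2 ^ 2 * 3 from hpn) with h' | h'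
    · exact absurd ((Nat.prime_dvd_prime_iff_eq hp Nat.prime_two).mp (hp.dvd_of_dvd_pow h')) hp2
    · exact absurd ((Nat.prime_dvd_prime_iff_eq hp Nat.prime_three).mp h') hp3
  have hcop : Nat.Coprime (2 * 3 ^ 6) p := Nat.Coprime.mul_left hpc2 (hpc3.pow_left 6)
  have hle := sigma_one_mul_le_of_dvd hn
    (hcop.mul_dvd_of_dvd_of_dvd (two_mul_three_pow_six_dvd hn heven hσ h12 hne) hpn)
  have sp : ArithmeticFunction.sigma 1 p = p + 1 := by
    rw [ArithmeticFunction.sigma_one_apply, hp.sum_divisors, add_comm]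
  have s1458 : ArithmeticFunction.sigma 1 (2 * 3 ^ 6) = 3279 := by
    rw [ArithmeticFunction.isMultiplicative_sigma.map_mul_of_coprime (by norm_num),
      ArithmeticFunction.sigma_one_apply_prime_pow Nat.prime_three,
      ArithmeticFunction.sigma_one_apply 2, Nat.prime_two.sum_divisors]
    decide
  rw [ArithmeticFunction.isMultiplicative_sigma.map_mul_of_coprime hcop, sp, s1458] at hle
  have hp27 : 27 ≤ p := by
    by_contra! hlt
    nlinarith
  by_contra! hlt
  interval_cases p <;> norm_num at hp
end

section
/- If n is an even positive integer with I(n) = 7/3 and n ∉ {12, 234}, then n = 2 · 3^{2a} · q^e · ∏_{i=1}^{k} p_i^{2e_i}, where q, p_1, …, p_k are distinct primes each at least 29, a, e, e_1, …, e_k are positive integers, a ≥ 3, k ≥ 2, and q ≡ e ≡ 1 (mod 4). -/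
open ArithmeticFunction in
/-- The abundancy index `σ(n) / n`. -/
def abundancy (n : ℕ) : ℚ := (sigma 1 n : ℚ) / n

section Sigma

open ArithmeticFunction

lemma sigma_one_mul_lt {d c : ℕ} (hd : 0 < d) (hc : 1 < c) :
    c * sigma 1 d < sigma 1 (d * c) := by
  have hsub : insert 1 (d.divisors.image (c * ·)) ⊆ (d * c).divisors := by
    intro x hx
    rcases Finset.mem_insert.1 hx with rfl | hx
    · simp; lia
    · obtain ⟨y, hy, rfl⟩ := Finset.mem_image.1 hx
      rw [Nat.mem_divisors] at hy ⊢
      exact ⟨by rw [mul_comm d]; exact mul_dvd_mul_left _ hy.1, by positivity⟩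
  have hnot : 1 ∉ d.divisors.image (c * ·) := by
    simp only [Finset.mem_image, not_exists, not_and]
    intro y _ hy
    exact hc.ne' (Nat.eq_one_of_mul_eq_one_right hy)
  have hle := Finset.sum_le_sum_of_subset (f := fun x : ℕ => x) hsub
  rw [Finset.sum_insert hnot,
    Finset.sum_image (fun a _ b _ hab => Nat.eq_of_mul_eq_mul_left (by lia) hab),
    ← Finset.mul_sum, ← sigma_one_apply, ← sigma_one_apply] at hle
  lia

lemma abundancy_le_of_dvd {d n : ℕ} (hn : n ≠ 0) (h : d ∣ n) : abundancy d ≤ abundancy n := by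
  obtain ⟨c, rfl⟩ := h
  have hd : 0 < d := Nat.pos_of_ne_zero (left_ne_zero_of_mul hn)
  have hc : 0 < c := Nat.pos_of_ne_zero (right_ne_zero_of_mul hn)
  have key : c * sigma 1 d ≤ sigma 1 (d * c) := by
    rcases (show 1 ≤ c from hc).eq_or_lt with rfl | hc
    · simp
    · exact (sigma_one_mul_lt hd hc).le
  have key' : (c : ℚ) * sigma 1 d ≤ sigma 1 (d * c) := by exact_mod_cast key
  unfold abundancy
  rw [div_le_div_iff₀ (by positivity) (by positivity)]
  push_cast
  have hd' : (0 : ℚ) < d := by exact_mod_cast hd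
  nlinarith

lemma abundancy_pos {n : ℕ} (hn : 0 < n) : 0 < abundancy n := by
  have : abundancy 1 ≤ abundancy n := abundancy_le_of_dvd hn.ne' (one_dvd n)
  simp only [abundancy, sigma_one, Nat.cast_one, div_one] at this ⊢
  linarith

lemma abundancy_mul_of_coprime {a b : ℕ} (h : a.Coprime b) :
    abundancy (a * b) = abundancy a * abundancy b := by
  unfold abundancy
  rw [isMultiplicative_sigma.map_mul_of_coprime h]
  push_cast
  rw [mul_div_mul_comm]

lemma sub_one_mul_sigma_one_prime_pow {p : ℕ} (hp : p.Prime) (k : ℕ) :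
    ((p : ℚ) - 1) * sigma 1 (p ^ k) = p ^ (k + 1) - 1 := by
  rw [sigma_one_apply_prime_pow hp]
  push_cast
  exact mul_geom_sum _ _

lemma abundancy_prime_pow {p : ℕ} (hp : p.Prime) (k : ℕ) :
    abundancy (p ^ k) = (p - (1 / p : ℚ) ^ k) / (p - 1) := by
  have h1 : (1 : ℚ) < p := by exact_mod_cast hp.one_lt
  have h2 : (p : ℚ) - 1 ≠ 0 := by linarith
  unfold abundancy
  rw [eq_div_iff h2, div_mul_eq_mul_div, mul_comm, sub_one_mul_sigma_one_prime_pow hp]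
  have h3 : (1 / p : ℚ) ^ k * p ^ k = 1 := by
    rw [← mul_pow, one_div_mul_cancel (by linarith), one_pow]
  push_cast
  rw [div_eq_iff (pow_ne_zero _ (by linarith))]
  linear_combination h3

lemma abundancy_prime_pow_lt {p : ℕ} (hp : p.Prime) (k : ℕ) :
    abundancy (p ^ k) < p / (p - 1) := by
  have h1 : (1 : ℚ) < p := by exact_mod_cast hp.one_lt
  have h2 : (0 : ℚ) < p - 1 := by linarith
  rw [abundancy_prime_pow hp]
  gcongr
  have : (0 : ℚ) < (1 / p) ^ k := by positivity
  linarith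

lemma abundancy_prime {p : ℕ} (hp : p.Prime) : abundancy p = (p + 1) / p := by
  have h1 : (1 : ℚ) < p := by exact_mod_cast hp.one_lt
  have h2 : (p : ℚ) - 1 ≠ 0 := by linarith
  have := abundancy_prime_pow hp 1
  rw [pow_one] at this
  rw [this]
  field_simp
  ring

lemma odd_sigma_one_prime_pow_iff {p : ℕ} (hp : p.Prime) (hp2 : Odd p) (k : ℕ) :
    Odd (sigma 1 (p ^ k)) ↔ Even k := by
  rw [sigma_one_apply_prime_pow hp, Finset.odd_sum_iff_odd_card_odd,
    Finset.filter_true_of_mem fun i _ => hp2.pow, Finset.card_range]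
  grind

lemma isSquare_of_odd_sigma_one {m : ℕ} (hm : Odd m) (h : Odd (sigma 1 m)) :
    IsSquare m := by
  induction m using Nat.recOnPosPrimePosCoprime with
  | prime_pow p k hp hk =>
    have hp2 : Odd p := (Nat.odd_pow_iff hk.ne').1 hm
    exact ((odd_sigma_one_prime_pow_iff hp hp2 k).1 h).isSquare_pow p
  | zero => exact IsSquare.zero
  | one => exact IsSquare.one
  | coprime a b _ _ hab iha ihb =>
    rw [isMultiplicative_sigma.map_mul_of_coprime hab, Nat.odd_mul] at h
    rw [Nat.odd_mul] at hm
    exact (iha hm.1 h.1).mul (ihb hm.2 h.2)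

lemma prime_pow_mod_four_of_sigma_one {p k : ℕ} (hp : p.Prime) (hp2 : Odd p)
    (h : sigma 1 (p ^ k) % 4 = 2) : p % 4 = 1 ∧ k % 4 = 1 := by
  have hk : ¬ Even k := by
    rw [← odd_sigma_one_prime_pow_iff hp hp2]
    grind
  obtain ⟨j, rfl⟩ := Nat.not_even_iff_odd.1 hk
  have hsum : sigma 1 (p ^ (2 * j + 1)) = (1 + p) * ∑ i ∈ Finset.range (j + 1), (p ^ 2) ^ i := by
    rw [sigma_one_apply_prime_pow hp]
    clear h hk
    induction j with
    | zero => simp [Finset.sum_range_succ]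
    | succ j ih =>
      rw [Finset.sum_range_succ (fun i => (p ^ 2) ^ i) (j + 1), mul_add (1 + p), ← ih,
        show 2 * (j + 1) + 1 + 1 = 2 * j + 1 + 1 + 1 + 1 by ring,
        Finset.sum_range_succ, Finset.sum_range_succ]
      ring
  have hp1 : p % 4 = 1 := by
    by_contra hne
    have : 4 ∣ sigma 1 (p ^ (2 * j + 1)) := by
      rw [hsum]
      exact Dvd.dvd.mul_right (by grind) _
    lia
  refine ⟨hp1, ?_⟩
  have hj : (∑ i ∈ Finset.range (j + 1), (p ^ 2) ^ i) ≡ j + 1 [MOD 4] := by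
    have : ∀ i ∈ Finset.range (j + 1), (p ^ 2) ^ i ≡ 1 [MOD 4] := fun i _ => by
      have h1 : p ≡ 1 [MOD 4] := hp1
      simpa using (h1.pow 2).pow i
    simpa using Nat.ModEq.sum this
  have h3 : sigma 1 (p ^ (2 * j + 1)) ≡ 2 * (j + 1) [MOD 4] := by
    rw [hsum]
    refine Nat.ModEq.mul ?_ hj
    change (1 + p) % 4 = 2 % 4
    lia
  have h4 : sigma 1 (p ^ (2 * j + 1)) % 4 = 2 * (j + 1) % 4 := h3
  lia

/-- Euler's form for odd numbers whose divisor sum is `2` modulo `4`. -/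
lemma exists_eq_prime_pow_mul_sq {m : ℕ} (hm : Odd m) (h : sigma 1 m % 4 = 2) :
    ∃ q e w : ℕ, q.Prime ∧ q % 4 = 1 ∧ e % 4 = 1 ∧ ¬ q ∣ w ∧ m = q ^ e * w ^ 2 := by
  induction m using Nat.recOnPosPrimePosCoprime with
  | prime_pow p k hp hk =>
    obtain ⟨h1, h2⟩ := prime_pow_mod_four_of_sigma_one hp ((Nat.odd_pow_iff hk.ne').1 hm) h
    exact ⟨p, k, 1, hp, h1, h2, hp.not_dvd_one, by simp⟩
  | zero => simp at h
  | one => simp at h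
  | coprime a b _ _ hab iha ihb =>
    rw [isMultiplicative_sigma.map_mul_of_coprime hab] at h
    rw [Nat.odd_mul] at hm
    have extend : ∀ {c d q e w : ℕ}, c.Coprime d → IsSquare d → q.Prime → e % 4 = 1 → ¬ q ∣ w →
        c = q ^ e * w ^ 2 → ∃ w', ¬ q ∣ w' ∧ c * d = q ^ e * w' ^ 2 := by
      rintro c d q e w hcd ⟨z, rfl⟩ hq he hw rfl
      refine ⟨w * z, ?_, by ring⟩
      intro hdvd
      rcases hq.dvd_mul.1 hdvd with hdvd | hdvd
      · exact hw hdvd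
      · refine Nat.not_coprime_of_dvd_of_dvd hq.one_lt ?_ (hdvd.mul_right z) hcd
        exact (dvd_pow_self q (by lia)).mul_right _
    have hcase : (sigma 1 a % 4 = 2 ∧ Odd (sigma 1 b)) ∨ (Odd (sigma 1 a) ∧ sigma 1 b % 4 = 2) := by
      rw [Nat.mul_mod] at h
      rw [Nat.odd_iff, Nat.odd_iff]
      have ha := Nat.mod_lt (sigma 1 a) (show 4 > 0 by norm_num)
      have hb := Nat.mod_lt (sigma 1 b) (show 4 > 0 by norm_num)
      generalize hA : sigma 1 a % 4 = A at *
      generalize hB : sigma 1 b % 4 = B at *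
      interval_cases A <;> interval_cases B <;> simp_all <;> lia
    rcases hcase with ⟨ha, hb⟩ | ⟨ha, hb⟩
    · obtain ⟨q, e, w, hq, hq4, he4, hw, heq⟩ := iha hm.1 ha
      obtain ⟨w', hw', heq'⟩ := extend hab (isSquare_of_odd_sigma_one hm.2 hb) hq he4 hw heq
      exact ⟨q, e, w', hq, hq4, he4, hw', heq'⟩
    · obtain ⟨q, e, w, hq, hq4, he4, hw, heq⟩ := ihb hm.2 hb
      obtain ⟨w', hw', heq'⟩ := extend hab.symm (isSquare_of_odd_sigma_one hm.1 ha) hq he4 hw heq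
      exact ⟨q, e, w', hq, hq4, he4, hw', by rw [mul_comm a, heq']⟩

lemma eq_of_prime_of_le {r : ℕ} (hr : r.Prime) (h29 : 29 ≤ r) (h54 : r ≤ 54) :
    r = 29 ∨ r = 31 ∨ r = 37 ∨ r = 41 ∨ r = 43 ∨ r = 47 ∨ r = 53 := by
  interval_cases r <;> revert hr <;> norm_num

/-- Bounds on the abundancy index that restrict a two-prime product narrowly. The upper bound is
`(14 / 9) / abundancy (3 ^ 12)`. -/
lemma eq_of_abundancy_two_prime_powers {r s x y : ℕ} (hr : r.Prime) (hs : s.Prime) (hr29 : 29 ≤ r)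
    (hrs : r < s) (hx : x ≠ 0) (hy : y ≠ 0)
    (hlo : 28 / 27 < abundancy (r ^ x) * abundancy (s ^ y))
    (hhi : abundancy (r ^ x) * abundancy (s ^ y) ≤ 28 * 531441 / (9 * 1594322)) :
    (r = 31 ∧ x = 2 ∧ s = 277) ∨ (r = 37 ∧ x = 1 ∧ s = 103) ∨ (r = 47 ∧ s = 67) := by
  have hr0 : (29 : ℚ) ≤ r := by exact_mod_cast hr29
  have hs0 : (r : ℚ) + 1 ≤ s := by exact_mod_cast hrs
  have hX := abundancy_prime_pow_lt hr x
  have hY := abundancy_prime_pow_lt hs y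
  have hX0 : 0 < abundancy (r ^ x) := abundancy_pos (pow_pos hr.pos x)
  have hY0 : 0 < abundancy (s ^ y) := abundancy_pos (pow_pos hs.pos y)
  have hY1 : ((s : ℚ) + 1) / s ≤ abundancy (s ^ y) := by
    rw [← abundancy_prime hs]
    exact abundancy_le_of_dvd (pow_ne_zero _ hs.ne_zero) (dvd_pow_self s hy)
  have hr54 : r ≤ 54 := by
    have h1 : (s : ℚ) / (s - 1) ≤ (r + 1) / r := by
      rw [div_le_div_iff₀ (by linarith) (by linarith)]
      nlinarith
    have h2 : (28 / 27 : ℚ) < r / (r - 1) * ((r + 1) / r) :=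
      hlo.trans (mul_lt_mul'' hX (hY.trans_le h1) hX0.le hY0.le)
    rw [div_mul_div_cancel₀' (by linarith), div_lt_div_iff₀ (by norm_num) (by linarith)] at h2
    have h3 : (r : ℚ) < 55 := by linarith
    have : r < 55 := by exact_mod_cast h3
    lia
  have hr7 := eq_of_prime_of_le hr hr29 hr54
  have upper : ∀ N D : ℕ, 0 < D → abundancy (r ^ x) ≤ N / D → 28 * D * s < 27 * N * s + 28 * D := by
    intro N D hD hN
    have h2 : (28 / 27 : ℚ) < N / D * (s / (s - 1)) :=
      hlo.trans (mul_lt_mul' hN hY hY0.le (hX0.trans_le hN))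
    have hD' : (0 : ℚ) < D := by exact_mod_cast hD
    rw [div_mul_div_comm, div_lt_div_iff₀ (by norm_num) (mul_pos hD' (by linarith))] at h2
    have h3 : (28 * D * s : ℚ) < 27 * N * s + 28 * D := by linarith
    exact_mod_cast h3
  have lower : ∀ N D : ℕ, 0 < D → (N : ℚ) / D ≤ abundancy (r ^ x) →
      9 * 1594322 * N * (s + 1) ≤ 28 * 531441 * D * s := by
    intro N D hD hN
    have h2 : (N : ℚ) / D * ((s + 1) / s) ≤ 28 * 531441 / (9 * 1594322) :=
      (mul_le_mul hN hY1 (div_nonneg (by linarith) (by linarith)) hX0.le).trans hhi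
    have hD' : (0 : ℚ) < D := by exact_mod_cast hD
    rw [div_mul_div_comm, div_le_div_iff₀ (mul_pos hD' (by linarith)) (by norm_num)] at h2
    have h3 : (9 * 1594322 * N * (s + 1) : ℚ) ≤ 28 * 531441 * D * s := by linarith
    exact_mod_cast h3
  have hpow : ∀ k, abundancy (r ^ k) = (∑ i ∈ Finset.range (k + 1), r ^ i : ℕ) / (r ^ k : ℕ) :=
    fun k => by rw [abundancy, sigma_one_apply_prime_pow hr]
  have hs' : s ≠ 405 ∧ s ≠ 759 ∧ s ≠ 782 ∧ s ≠ 783 ∧ s ≠ 216 ∧ s ≠ 279 ∧ s ≠ 111 ∧ s ≠ 81 ∧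
      s ≠ 86 ∧ s ≠ 75 ∧ s ≠ 78 ∧ s ≠ 65 ∧ s ≠ 57 ∧ s ≠ 58 := by
    refine ⟨?_, ?_, ?_, ?_, ?_, ?_, ?_, ?_, ?_, ?_, ?_, ?_, ?_, ?_⟩ <;> rintro rfl <;>
      norm_num at hs
  have exact_bounds := fun k (hk : x = k) =>
    And.intro (upper _ _ (pow_pos hr.pos k) (by rw [hk]; exact (hpow k).le))
      (lower _ _ (pow_pos hr.pos k) (by rw [hk]; exact (hpow k).ge))
  have hx3 : x = 1 ∨ x = 2 ∨ 3 ≤ x := by lia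
  rcases hx3 with hx | hx | hx
  · obtain ⟨hu, hl⟩ := exact_bounds 1 hx
    clear exact_bounds upper lower hpow
    simp only [Finset.sum_range_succ, Finset.sum_range_zero] at hu hl
    rcases hr7 with rfl | rfl | rfl | rfl | rfl | rfl | rfl <;> lia
  · obtain ⟨hu, hl⟩ := exact_bounds 2 hx
    clear exact_bounds upper lower hpow
    simp only [Finset.sum_range_succ, Finset.sum_range_zero] at hu hl
    rcases hr7 with rfl | rfl | rfl | rfl | rfl | rfl | rfl <;> lia
  · have hl := lower _ _ (pow_pos hr.pos 3) <| (hpow 3).symm.trans_le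
      (abundancy_le_of_dvd (pow_ne_zero _ hr.ne_zero) (pow_dvd_pow r hx))
    have hu := upper r (r - 1) (by lia) (by rw [Nat.cast_pred hr.pos]; exact hX.le)
    clear exact_bounds upper lower hpow
    simp only [Finset.sum_range_succ, Finset.sum_range_zero] at hl
    rcases hr7 with rfl | rfl | rfl | rfl | rfl | rfl | rfl <;> lia

lemma dvd_of_dvd_sigma_one {t A B l : ℕ} (ht : 9 * sigma 1 t = 14 * t) (htAB : t = A * B)
    (hAB : A.Coprime B) (hl : l.Prime) (hl7 : 7 < l) (hA : l ∣ sigma 1 A) : l ∣ t := by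
  have h1 : l ∣ 14 * t := by
    rw [← ht, htAB, isMultiplicative_sigma.map_mul_of_coprime hAB]
    exact (hA.mul_right _).mul_left _
  refine (hl.dvd_mul.1 h1).resolve_left fun h14 => ?_
  have : l ≤ 14 := Nat.le_of_dvd (by norm_num) h14
  interval_cases l <;> revert hl h14 <;> norm_num

lemma abundancy_eq_of_sigma_one {t : ℕ} (ht : 9 * sigma 1 t = 14 * t) (ht0 : 0 < t) :
    abundancy t = 14 / 9 := by
  have h : (9 : ℚ) * sigma 1 t = 14 * t := by exact_mod_cast ht
  have ht0' : (0 : ℚ) < t := by exact_mod_cast ht0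
  rw [abundancy, div_eq_div_iff ht0'.ne' (by norm_num)]
  linarith

lemma prime_ge_of_dvd {t p : ℕ} (ht : 9 * sigma 1 t = 14 * t) (ht0 : 0 < t) (h81 : 3 ^ 4 ∣ t)
    (hp : p.Prime) (hpt : p ∣ t) (hp3 : p ≠ 3) : 29 ≤ p := by
  have hcop : (3 ^ 4).Coprime p :=
    ((Nat.coprime_primes Nat.prime_three hp).2 hp3.symm).pow_left 4
  have hle := abundancy_le_of_dvd ht0.ne' (hcop.mul_dvd_of_dvd_of_dvd h81 hpt)
  have hp0 : (0 : ℚ) < p := by exact_mod_cast hp.pos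
  rw [abundancy_eq_of_sigma_one ht ht0, abundancy_mul_of_coprime hcop,
    abundancy_prime_pow Nat.prime_three, abundancy_prime hp, mul_div_assoc', div_le_iff₀ hp0] at hle
  have h24 : (24 : ℚ) < p := by norm_num at hle; linarith
  have : 24 < p := by exact_mod_cast h24
  by_contra! hlt
  interval_cases p <;> revert hp <;> norm_num

/-- Numbers with at least two prime factors, written as products indexed by `Fin k`. -/
lemma exists_sq_eq_prod_primes {v : ℕ} (hv : 1 < v) (hpow : ¬ IsPrimePow v) :
    ∃ (k : ℕ) (p E : Fin k → ℕ), 2 ≤ k ∧ (∀ i, (p i).Prime ∧ p i ∣ v ∧ 0 < E i) ∧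
      Function.Injective p ∧ v ^ 2 = ∏ i, p i ^ (2 * E i) := by
  let f := v.primeFactors.equivFin
  have hmem : ∀ i, (f.symm i : ℕ) ∈ v.primeFactors := fun i => (f.symm i).2
  refine ⟨v.primeFactors.card, fun i => f.symm i, fun i => v.factorization (f.symm i), ?_,
    fun i => ⟨Nat.prime_of_mem_primeFactors (hmem i), Nat.dvd_of_mem_primeFactors (hmem i), ?_⟩,
    Subtype.val_injective.comp f.symm.injective, ?_⟩
  · rw [isPrimePow_iff_card_primeFactors_eq_one] at hpow
    have : 0 < v.primeFactors.card := Finset.card_pos.2 (Nat.nonempty_primeFactors.2 hv)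
    lia
  · exact (Nat.prime_of_mem_primeFactors (hmem i)).factorization_pos_of_dvd (by lia)
      (Nat.dvd_of_mem_primeFactors (hmem i))
  · rw [f.symm.prod_comp fun z : v.primeFactors => (z : ℕ) ^ (2 * v.factorization z),
      Finset.prod_coe_sort v.primeFactors fun z => z ^ (2 * v.factorization z)]
    conv_lhs => rw [← Nat.prod_factorization_pow_eq_self (n := v) (by lia)]
    rw [Finsupp.prod, Nat.support_factorization, ← Finset.prod_pow]
    exact Finset.prod_congr rfl fun z _ => by rw [← pow_mul, mul_comm]

lemma lt_abundancy_cofactor {b m : ℕ} (ht : 9 * sigma 1 (3 ^ b * m) = 14 * (3 ^ b * m))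
    (hm : 0 < m) (h3m : (3 ^ b).Coprime m) : 28 / 27 < abundancy m := by
  have h := abundancy_eq_of_sigma_one ht (by positivity)
  have hlt := abundancy_prime_pow_lt Nat.prime_three b
  rw [abundancy_mul_of_coprime h3m] at h
  norm_num at hlt
  nlinarith [abundancy_pos hm]

lemma abundancy_cofactor_le {b m : ℕ} (ht : 9 * sigma 1 (3 ^ b * m) = 14 * (3 ^ b * m))
    (hm : 0 < m) (h3m : (3 ^ b).Coprime m) (hb : 12 ≤ b) :
    abundancy m ≤ 28 * 531441 / (9 * 1594322) := by
  have h := abundancy_eq_of_sigma_one ht (by positivity)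
  have hle : abundancy (3 ^ 12) ≤ abundancy (3 ^ b) :=
    abundancy_le_of_dvd (by positivity) (pow_dvd_pow 3 hb)
  rw [abundancy_mul_of_coprime h3m] at h
  rw [abundancy_prime_pow Nat.prime_three] at hle
  norm_num at hle ⊢
  nlinarith [abundancy_pos hm]

lemma sigma_one_three_pow (b : ℕ) : 2 * sigma 1 (3 ^ b) + 1 = 3 ^ (b + 1) := by
  have h := sub_one_mul_sigma_one_prime_pow Nat.prime_three b
  have h' : (2 * sigma 1 (3 ^ b) + 1 : ℚ) = 3 ^ (b + 1) := by
    push_cast at h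
    linarith
  exact_mod_cast h'

lemma false_of_two_prime_powers {a q e p f : ℕ} (ha : a = 3 ∨ 6 ≤ a) (hq : q.Prime) (hp : p.Prime)
    (hq4 : q % 4 = 1) (he : e ≠ 0) (hf : f ≠ 0) (hqp : q ≠ p) (hq29 : 29 ≤ q) (hp29 : 29 ≤ p)
    (ht : 9 * sigma 1 (3 ^ (2 * a) * (q ^ e * p ^ (2 * f))) =
      14 * (3 ^ (2 * a) * (q ^ e * p ^ (2 * f)))) : False := by
  have hcop : (q ^ e).Coprime (p ^ (2 * f)) := ((Nat.coprime_primes hq hp).2 hqp).pow _ _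
  have h3q : (3 ^ (2 * a)).Coprime (q ^ e) :=
    ((Nat.coprime_primes Nat.prime_three hq).2 (by lia)).pow _ _
  have h3p : (3 ^ (2 * a)).Coprime (p ^ (2 * f)) :=
    ((Nat.coprime_primes Nat.prime_three hp).2 (by lia)).pow _ _
  have h3m := h3q.mul_right h3p
  have hm : 0 < q ^ e * p ^ (2 * f) := mul_pos (pow_pos hq.pos _) (pow_pos hp.pos _)
  have hdvd : ∀ l, l.Prime → l ∣ 3 ^ (2 * a) * (q ^ e * p ^ (2 * f)) → l = 3 ∨ l = q ∨ l = p := by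
    intro l hl h
    rw [hl.dvd_mul, hl.dvd_mul] at h
    exact h.imp (fun h => Nat.prime_eq_prime_of_dvd_pow hl Nat.prime_three h)
      (Or.imp (Nat.prime_eq_prime_of_dvd_pow hl hq) (Nat.prime_eq_prime_of_dvd_pow hl hp))
  have hlo := lt_abundancy_cofactor ht hm h3m
  have hmul := abundancy_mul_of_coprime hcop
  rcases ha with rfl | ha
  · have h1093 : 1093 ∣ sigma 1 (3 ^ (2 * 3)) := by
      have := sigma_one_three_pow (2 * 3)
      norm_num at this ⊢
      lia
    have hqX := abundancy_prime_pow_lt hq e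
    have hpX := abundancy_prime_pow_lt hp (2 * f)
    have hq0 := abundancy_pos (pow_pos hq.pos e)
    have hp0 := abundancy_pos (pow_pos hp.pos (2 * f))
    have small : ∀ r : ℕ, 29 ≤ r → (r : ℚ) / (r - 1) ≤ 29 / 28 := by
      intro r hr
      have hr' : (29 : ℚ) ≤ r := by exact_mod_cast hr
      rw [div_le_div_iff₀ (by linarith) (by norm_num)]
      linarith
    have hprod : (28 / 27 : ℚ) < 29 / 28 * (1093 / 1092) := by
      rcases hdvd 1093 (by norm_num) (dvd_of_dvd_sigma_one ht rfl h3m (by norm_num) (by norm_num)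
        h1093) with h | rfl | rfl
      · lia
      · rw [hmul, mul_comm] at hlo
        norm_num at hqX
        exact hlo.trans (mul_lt_mul'' (hpX.trans_le (small p hp29)) hqX hp0.le hq0.le)
      · rw [hmul] at hlo
        norm_num at hpX
        exact hlo.trans (mul_lt_mul'' (hqX.trans_le (small q hq29)) hpX hq0.le hp0.le)
    norm_num at hprod
  · have hhi := abundancy_cofactor_le ht hm h3m (by lia)
    rw [hmul] at hlo hhi
    rcases hqp.lt_or_gt with hlt | hlt
    · rcases eq_of_abundancy_two_prime_powers hq hp hq29 hlt he (by lia) hlo hhi with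
        ⟨rfl, -, -⟩ | ⟨rfl, rfl, rfl⟩ | ⟨rfl, -⟩
      · lia
      · have h19 : 19 ∣ sigma 1 (37 ^ 1) := by
          rw [sigma_one_apply_prime_pow hq]
          norm_num [Finset.sum_range_succ]
        have := hdvd 19 (by norm_num) (dvd_of_dvd_sigma_one ht (mul_left_comm _ _ _)
          (h3q.symm.mul_right hcop) (by norm_num) (by norm_num) h19)
        lia
      · lia
    · rw [mul_comm] at hlo hhi
      rcases eq_of_abundancy_two_prime_powers hp hq hp29 hlt (by lia) he hlo hhi with
        ⟨rfl, hf2, rfl⟩ | ⟨-, hf1, -⟩ | ⟨-, rfl⟩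
      · have h331 : 331 ∣ sigma 1 (31 ^ (2 * f)) := by
          rw [hf2, sigma_one_apply_prime_pow hp]
          norm_num [Finset.sum_range_succ]
        have := hdvd 331 (by norm_num) (dvd_of_dvd_sigma_one ht
          (by rw [← mul_assoc, mul_comm]) (h3p.symm.mul_right hcop.symm) (by norm_num)
          (by norm_num) h331)
        lia
      · lia
      · lia

/-- The form of odd numbers with `9 σ(t) = 14 t`, the odd parts of friends of `12`. -/
lemma exists_prime_factorization_of_sigma_one {t : ℕ} (hodd : Odd t)
    (ht : 9 * sigma 1 t = 14 * t) (ht117 : t ≠ 117) :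
    ∃ (a e k q : ℕ) (p E : Fin k → ℕ),
      q.Prime ∧ 29 ≤ q ∧ q % 4 = 1 ∧ 0 < e ∧ e % 4 = 1 ∧
      3 ≤ a ∧ 2 ≤ k ∧
      (∀ i, (p i).Prime ∧ 29 ≤ p i ∧ 0 < E i) ∧
      Function.Injective p ∧ (∀ i, p i ≠ q) ∧
      t = 3 ^ (2 * a) * q ^ e * ∏ i, p i ^ (2 * E i) := by
  have ht0 : 0 < t := hodd.pos
  obtain ⟨q, e, w, hq, hq4, he4, hqw, htw⟩ := exists_eq_prime_pow_mul_sq hodd (by grind)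
  have hq3 : q ≠ 3 := by lia
  have hw0 : w ≠ 0 := by rintro rfl; simp at hqw
  obtain ⟨a, v, h3v, rfl⟩ := Nat.exists_eq_pow_mul_and_not_dvd hw0 3 (by norm_num)
  have hv0 : v ≠ 0 := right_ne_zero_of_mul hw0
  have hqv : ¬ q ∣ v := fun h => hqw (h.mul_left _)
  replace htw : t = 3 ^ (2 * a) * (q ^ e * v ^ 2) := by rw [htw]; ring
  have hm0 : 0 < q ^ e * v ^ 2 := mul_pos (pow_pos hq.pos _) (by positivity)
  have h3 : Nat.Coprime 3 (q ^ e * v ^ 2) :=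
    (((Nat.coprime_primes Nat.prime_three hq).2 hq3.symm).pow_right e).mul_right
      (((Nat.Prime.coprime_iff_not_dvd Nat.prime_three).2 h3v).pow_right 2)
  have h3m : (3 ^ (2 * a)).Coprime (q ^ e * v ^ 2) := h3.pow_left _
  have dvd_t : ∀ l b, a = b → l.Prime → 7 < l → l ∣ sigma 1 (3 ^ (2 * b)) → l ∣ t :=
    fun l b hab hl hl7 h => dvd_of_dvd_sigma_one ht htw h3m hl hl7 (hab ▸ h)
  have sigma_dvd : ∀ b l c, 2 * (l * c) + 1 = 3 ^ (2 * b + 1) → l ∣ sigma 1 (3 ^ (2 * b)) :=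
    fun b l c h => ⟨c, by have := sigma_one_three_pow (2 * b); lia⟩
  have ha0 : a ≠ 0 := by
    rintro rfl
    have : 3 ∣ t := by lia
    rw [htw, mul_zero, pow_zero, one_mul] at this
    exact Nat.prime_three.one_lt.ne' (h3.eq_one_of_dvd this)
  have h9 : 3 ^ (2 * a) ∣ t := htw ▸ dvd_mul_right _ _
  have ha1 : a ≠ 1 := by
    intro ha
    have h13 : 13 ∣ t := dvd_t 13 1 ha (by norm_num) (by norm_num) (sigma_dvd 1 13 1 (by norm_num))
    rw [ha] at h9
    obtain ⟨c, rfl⟩ : 117 ∣ t :=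
      Nat.Coprime.mul_dvd_of_dvd_of_dvd (m := 9) (n := 13) (by norm_num) h9 h13
    have := sigma_one_mul_lt (d := 117) (c := c) (by norm_num) (by lia)
    have h117 : sigma 1 117 = 182 := by decide
    lia
  have hge : ∀ p : ℕ, p.Prime → p ∣ q ^ e * v ^ 2 → 29 ≤ p := fun p hp hpm =>
    prime_ge_of_dvd ht ht0 ((pow_dvd_pow 3 (by lia)).trans h9) hp (htw ▸ hpm.mul_left _) (by
      rintro rfl
      exact Nat.prime_three.one_lt.ne' (h3.eq_one_of_dvd hpm))
  have no_small : ∀ b l c, l.Prime → 7 < l → l < 29 → 2 * (l * c) + 1 = 3 ^ (2 * b + 1) →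
      a ≠ b := by
    intro b l c hl hl7 hl29 h hab
    have hlt := dvd_t l b hab hl hl7 (sigma_dvd b l c h)
    have := prime_ge_of_dvd ht ht0 ((pow_dvd_pow 3 (by lia)).trans h9) hl hlt (by lia)
    lia
  have ha2 := no_small 2 11 11 (by norm_num) (by norm_num) (by norm_num) (by norm_num)
  have ha4 := no_small 4 13 757 (by norm_num) (by norm_num) (by norm_num) (by norm_num)
  have ha5 := no_small 5 23 3851 (by norm_num) (by norm_num) (by norm_num) (by norm_num)
  have he0 : e ≠ 0 := by lia
  have hq29 : 29 ≤ q := hge q hq ((dvd_pow_self q he0).mul_right _)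
  have hv1 : v ≠ 1 := by
    rintro rfl
    have hlo := lt_abundancy_cofactor (htw ▸ ht) hm0 h3m
    rw [one_pow, mul_one] at hlo
    have hlt := hlo.trans (abundancy_prime_pow_lt hq e)
    have hq' : (29 : ℚ) ≤ q := by exact_mod_cast hq29
    rw [div_lt_div_iff₀ (by norm_num) (by linarith)] at hlt
    linarith
  have hvpow : ¬ IsPrimePow v := by
    rw [isPrimePow_nat_iff]
    rintro ⟨p, f, hp, hf, rfl⟩
    rw [← pow_mul, mul_comm f 2] at htw hge
    have hpv : p ∣ p ^ f := dvd_pow_self p hf.ne'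
    exact false_of_two_prime_powers (by lia) hq hp hq4 he0 hf.ne' (fun h => hqv (h ▸ hpv)) hq29
      (hge p hp ((dvd_pow_self p (by lia)).mul_left _)) (htw ▸ ht)
  obtain ⟨k, p, E, hk, hpE, hinj, hprod⟩ := exists_sq_eq_prod_primes (by lia) hvpow
  refine ⟨a, e, k, q, p, E, hq, hq29, hq4, by lia, he4, by lia, hk, fun i => ?_, hinj,
    fun i h => hqv (h ▸ (hpE i).2.1), ?_⟩
  · obtain ⟨hi, hiv, hE⟩ := hpE i
    exact ⟨hi, hge _ hi ((hiv.trans (dvd_pow_self v (by norm_num))).mul_left _), hE⟩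
  · rw [← hprod, htw, mul_assoc]

end Sigma

/-- If `n` is an even positive integer with abundancy index `7/3` and
`n ∉ {12, 234}`, then `n = 2 * 3^(2a) * q^e * ∏ i, p i ^ (2 * e i)` where
`q` and the `p i` are distinct primes each at least `29`, `a ≥ 3`, `k ≥ 2`,
all exponents are positive, and `q ≡ e ≡ 1 (mod 4)`. -/
theorem even_friend_of_twelve_full_form (n : ℕ) (hn : 0 < n)
    (heven : Even n) (h : (ArithmeticFunction.sigma 1 n : ℚ) / n = 7 / 3)
    (h12 : n ≠ 12) (h234 : n ≠ 234) :
    ∃ (a e k q : ℕ) (p E : Fin k → ℕ),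
      q.Prime ∧ 29 ≤ q ∧ q % 4 = 1 ∧ 0 < e ∧ e % 4 = 1 ∧
      3 ≤ a ∧ 2 ≤ k ∧
      (∀ i, (p i).Prime ∧ 29 ≤ p i ∧ 0 < E i) ∧
      Function.Injective p ∧ (∀ i, p i ≠ q) ∧
      n = 2 * 3 ^ (2 * a) * q ^ e * ∏ i, p i ^ (2 * E i) := by
  have hs : 3 * ArithmeticFunction.sigma 1 n = 7 * n := by
    have hn' : (n : ℚ) ≠ 0 := by exact_mod_cast hn.ne'
    rw [div_eq_div_iff hn' (by norm_num)] at h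
    have h' : (3 * ArithmeticFunction.sigma 1 n : ℚ) = 7 * n := by linarith
    exact_mod_cast h'
  obtain ⟨t, rfl⟩ := even_iff_two_dvd.1 heven
  have hodd : Odd t := by
    by_contra heven
    obtain ⟨c, hc⟩ : 12 ∣ 2 * t := by grind
    have h12' : ArithmeticFunction.sigma 1 12 = 28 := by decide
    have := sigma_one_mul_lt (d := 12) (c := c) (by norm_num) (by lia)
    rw [hc] at hs
    lia
  have ht : 9 * ArithmeticFunction.sigma 1 t = 14 * t := by
    rw [ArithmeticFunction.isMultiplicative_sigma.map_mul_of_coprime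
      (Nat.coprime_two_left.2 hodd)] at hs
    have h2 : ArithmeticFunction.sigma 1 2 = 3 := by decide
    lia
  obtain ⟨a, e, k, q, p, E, hq, hq29, hq4, he, he4, ha, hk, hpE, hinj, hpq, heq⟩ :=
    exists_prime_factorization_of_sigma_one hodd ht (by lia)
  exact ⟨a, e, k, q, p, E, hq, hq29, hq4, he, he4, ha, hk, hpE, hinj, hpq, by rw [heq]; ring⟩
end

section
/- If n is an even positive integer with I(n) = 7/3 and n ∉ {12, 234}, and q is any prime divisor of n with q ∉ {2, 3}, then q divides n to an odd power only if q ≡ 1 (mod 4) and the q-adic valuation of n is ≡ 1 (mod 4); moreover exactly one prime divisor of n other than 2 divides n to an odd power. -/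
open ArithmeticFunction in
/-- A proper multiple of `12` has abundancy index larger than `7/3`. -/
theorem seven_mul_lt_three_mul_sigma_of_twelve_mul {k : ℕ} (hk : 1 < k) :
    7 * (12 * k) < 3 * sigma 1 (12 * k) := by
  have hsub : ({1, k, 2 * k, 3 * k, 4 * k, 6 * k, 12 * k} : Finset ℕ) ⊆ (12 * k).divisors := by
    intro d hd
    simp only [Finset.mem_insert, Finset.mem_singleton] at hd
    refine Nat.mem_divisors.mpr ⟨?_, by omega⟩
    rcases hd with rfl | rfl | rfl | rfl | rfl | rfl | rfl
    · exact one_dvd _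
    · exact dvd_mul_left _ _
    all_goals exact mul_dvd_mul_right (by norm_num) k
  have hle := Finset.sum_le_sum_of_subset (f := fun d : ℕ => d) hsub
  rw [← sigma_one_apply] at hle
  repeat rw [Finset.sum_insert (by simp only [Finset.mem_insert, Finset.mem_singleton]; omega)] at hle
  rw [Finset.sum_singleton] at hle
  omega

theorem geom_sum_mod_four_of_mod_four_eq_one {q : ℕ} (hq : q % 4 = 1) (m : ℕ) :
    (∑ i ∈ Finset.range m, q ^ i) % 4 = m % 4 := by
  induction m with
  | zero => rfl
  | succ m ih =>
    have : q ^ m % 4 = 1 := by simp [Nat.pow_mod, hq]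
    rw [Finset.sum_range_succ]
    omega

theorem geom_sum_mod_four_of_mod_four_eq_three {q : ℕ} (hq : q % 4 = 3) (m : ℕ) :
    (∑ i ∈ Finset.range m, q ^ i) % 4 = m % 2 := by
  induction m with
  | zero => rfl
  | succ m ih =>
    rw [geom_sum_succ, Nat.add_mod, Nat.mul_mod, hq, ih]
    rcases Nat.mod_two_eq_zero_or_one m with h | h <;> rw [h] <;> omega

/-- For odd `q` and odd `a`, the sum `1 + q + ⋯ + q ^ a` is even, and it is divisible by `4`
unless `q ≡ a ≡ 1 (mod 4)`. -/
theorem geom_sum_mod_four_of_odd {q a : ℕ} (hq : Odd q) (ha : Odd a) :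
    2 ∣ ∑ i ∈ Finset.range (a + 1), q ^ i ∧
      (4 ∣ ∑ i ∈ Finset.range (a + 1), q ^ i ∨ q % 4 = 1 ∧ a % 4 = 1) := by
  rw [Nat.odd_iff] at ha
  rcases Nat.odd_mod_four_iff.mp (Nat.odd_iff.mp hq) with h | h
  · have := geom_sum_mod_four_of_mod_four_eq_one h (a + 1)
    omega
  · have := geom_sum_mod_four_of_mod_four_eq_three h (a + 1)
    omega

theorem odd_geom_sum {q a : ℕ} (h : Even q ∨ Even a) :
    Odd (∑ i ∈ Finset.range (a + 1), q ^ i) := by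
  rcases Nat.even_or_odd q with hq | hq
  · rw [geom_sum_succ]
    exact (hq.mul_right _).add_one
  · have ha : Even a := h.resolve_left (Nat.not_even_iff_odd.mpr hq)
    rw [Nat.even_iff] at ha
    rw [Nat.odd_iff]
    rcases Nat.odd_mod_four_iff.mp (Nat.odd_iff.mp hq) with h | h
    · have := geom_sum_mod_four_of_mod_four_eq_one h (a + 1)
      omega
    · have := geom_sum_mod_four_of_mod_four_eq_three h (a + 1)
      omega

theorem sigma_one_eq_prod_geom_sum {n : ℕ} (hn : n ≠ 0) :
    ArithmeticFunction.sigma 1 n =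
      ∏ p ∈ n.primeFactors, ∑ i ∈ Finset.range (n.factorization p + 1), p ^ i := by
  rw [ArithmeticFunction.isMultiplicative_sigma.multiplicative_factorization _ hn,
    Finsupp.prod, Nat.support_factorization]
  refine Finset.prod_congr rfl fun p hp => ?_
  rw [ArithmeticFunction.sigma_one_apply_prime_pow (Nat.prime_of_mem_primeFactors hp)]

/-- If `σ(n) ≡ 2 (mod 4)`, then exactly one odd prime divides `n` to an odd power, and both this
prime and its exponent are `≡ 1 (mod 4)`. -/
theorem odd_exponent_of_sigma_mod_four {n : ℕ} (hn : n ≠ 0)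
    (hσ : ArithmeticFunction.sigma 1 n % 4 = 2) :
    (∀ q : ℕ, q.Prime → q ∣ n → q ≠ 2 →
      Odd (n.factorization q) → q % 4 = 1 ∧ n.factorization q % 4 = 1) ∧
    (∃! q : ℕ, q.Prime ∧ q ∣ n ∧ q ≠ 2 ∧ Odd (n.factorization q)) := by
  rw [sigma_one_eq_prod_geom_sum hn] at hσ
  refine ⟨fun q hq hqn hq2 hodd => ?_, existsUnique_of_exists_of_unique ?_ ?_⟩
  · refine (geom_sum_mod_four_of_odd (hq.odd_of_ne_two hq2) hodd).2.resolve_left fun h4 => ?_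
    have := h4.trans (Finset.dvd_prod_of_mem
      (fun p => ∑ i ∈ Finset.range (n.factorization p + 1), p ^ i)
      (Nat.mem_primeFactors.mpr ⟨hq, hqn, hn⟩))
    omega
  · by_contra! hne
    have : Odd (∏ p ∈ n.primeFactors, ∑ i ∈ Finset.range (n.factorization p + 1), p ^ i) := by
      refine Finset.prod_induction _ Odd (fun _ _ => Odd.mul) odd_one fun p hp => odd_geom_sum ?_
      by_cases hp2 : p = 2
      · exact .inl (hp2 ▸ even_two)
      · exact .inr (Nat.not_odd_iff_even.mp
          (hne p (Nat.prime_of_mem_primeFactors hp) (Nat.dvd_of_mem_primeFactors hp) hp2))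
    rw [Nat.odd_iff] at this
    omega
  · rintro p q ⟨hp, hpn, hp2, hpo⟩ ⟨hq, hqn, hq2, hqo⟩
    by_contra hpq
    have hsub : {p, q} ⊆ n.primeFactors := by
      simp [Finset.insert_subset_iff, hp, hpn, hq, hqn, hn]
    have hdvd := Finset.prod_dvd_prod_of_subset _ _
      (fun p => ∑ i ∈ Finset.range (n.factorization p + 1), p ^ i) hsub
    rw [Finset.prod_pair hpq] at hdvd
    have := (mul_dvd_mul (geom_sum_mod_four_of_odd (hp.odd_of_ne_two hp2) hpo).1
      (geom_sum_mod_four_of_odd (hq.odd_of_ne_two hq2) hqo).1).trans hdvd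
    omega


/-- If `n` is an even positive integer with abundancy index `7/3` and
`n ∉ {12, 234}`, then any prime divisor `q ∉ {2, 3}` of `n` dividing `n` to
an odd power satisfies `q ≡ 1 (mod 4)` and has `q`-adic valuation
`≡ 1 (mod 4)`; moreover exactly one prime divisor of `n` other than `2`
divides `n` to an odd power. -/
theorem even_friend_of_twelve_odd_exponent (n : ℕ) (hn : 0 < n)
    (heven : Even n) (h : (ArithmeticFunction.sigma 1 n : ℚ) / n = 7 / 3)
    (h12 : n ≠ 12) (h234 : n ≠ 234) :
    (∀ q : ℕ, q.Prime → q ∣ n → q ≠ 2 → q ≠ 3 →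
      Odd (n.factorization q) → q % 4 = 1 ∧ n.factorization q % 4 = 1) ∧
    (∃! q : ℕ, q.Prime ∧ q ∣ n ∧ q ≠ 2 ∧ Odd (n.factorization q)) := by
  have hσ : 3 * ArithmeticFunction.sigma 1 n = 7 * n := by
    rw [div_eq_div_iff (by positivity) (by norm_num)] at h
    rw [mul_comm]
    exact_mod_cast h
  have h4 : ¬ 4 ∣ n := by
    intro h4
    obtain ⟨k, rfl⟩ : 12 ∣ n := by omega
    have := seven_mul_lt_three_mul_sigma_of_twelve_mul (k := k) (by omega)
    omega
  rw [Nat.even_iff] at heven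
  obtain ⟨hmod, huniq⟩ := odd_exponent_of_sigma_mod_four hn.ne' (by omega)
  exact ⟨fun q hq hqn hq2 _ => hmod q hq hqn hq2, huniq⟩
end

section
/- If n is an even positive integer with I(n) = 7/3 and the 3-adic valuation of n equals 2, then 13 divides n; consequently 234 divides n and hence n = 234. -/
/-- Proper multiples have strictly larger abundancy index. -/
theorem mul_sigma_one_lt_sigma_one_mul {a k : ℕ} (ha : a ≠ 0) (hk : 1 < k) :
    k * ArithmeticFunction.sigma 1 a < ArithmeticFunction.sigma 1 (a * k) := by
  have h_not_mem : 1 ∉ a.divisors.image (k * ·) := by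
    simp only [Finset.mem_image, not_exists, not_and]
    intro d _ hd
    exact hk.ne' (Nat.eq_one_of_mul_eq_one_right hd)
  have h_subset : insert 1 (a.divisors.image (k * ·)) ⊆ (a * k).divisors := by
    intro x hx
    have hak : a * k ≠ 0 := mul_ne_zero ha (by lia)
    rcases Finset.mem_insert.1 hx with rfl | hx
    · simpa using hak
    · obtain ⟨d, hd, rfl⟩ := Finset.mem_image.1 hx
      rw [Nat.mem_divisors, mul_comm a]
      exact ⟨Nat.mul_dvd_mul_left k (Nat.dvd_of_mem_divisors hd), by rwa [mul_comm]⟩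
  rw [ArithmeticFunction.sigma_one_apply, ArithmeticFunction.sigma_one_apply]
  calc k * ∑ d ∈ a.divisors, d < 1 + k * ∑ d ∈ a.divisors, d := by lia
    _ = ∑ d ∈ insert 1 (a.divisors.image (k * ·)), d := by
      rw [Finset.sum_insert h_not_mem, Finset.sum_image, Finset.mul_sum]
      intro x _ y _ hxy
      exact Nat.eq_of_mul_eq_mul_left (by lia) hxy
    _ ≤ ∑ d ∈ (a * k).divisors, d := Finset.sum_le_sum_of_subset h_subset

/-- If `n` is an even positive integer with abundancy index `7/3` whose
3-adic valuation equals `2`, then `13 ∣ n`, hence `234 ∣ n` and `n = 234`. -/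
theorem even_friend_of_twelve_val_three_eq_two (n : ℕ) (hn : 0 < n)
    (heven : Even n) (h : (ArithmeticFunction.sigma 1 n : ℚ) / n = 7 / 3)
    (h3 : n.factorization 3 = 2) :
    13 ∣ n ∧ 234 ∣ n ∧ n = 234 := by
  have h_sigma : 3 * ArithmeticFunction.sigma 1 n = 7 * n := by
    have hn' : (n : ℚ) ≠ 0 := by exact_mod_cast hn.ne'
    rw [div_eq_div_iff hn' (by norm_num)] at h
    have h' : 3 * (ArithmeticFunction.sigma 1 n : ℚ) = 7 * n := by linarith
    exact_mod_cast h'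
  obtain ⟨m, hm⟩ : 9 ∣ n := by
    simpa [h3] using Nat.ordProj_dvd n 3
  have h_coprime : Nat.Coprime 9 m := by
    have h_cop := Nat.coprime_ordCompl Nat.prime_three hn.ne'
    rw [h3, hm, show 3 ^ 2 = 9 from rfl, Nat.mul_div_cancel_left m (by norm_num)] at h_cop
    exact h_cop.pow_left 2
  have h_mul : ArithmeticFunction.sigma 1 n = 13 * ArithmeticFunction.sigma 1 m := by
    rw [hm, ArithmeticFunction.isMultiplicative_sigma.map_mul_of_coprime h_coprime]
    congr 1
  have h13 : 13 ∣ n := by lia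
  have h2 : 2 ∣ n := heven.two_dvd
  have h234 : 234 ∣ n := by lia
  refine ⟨h13, h234, ?_⟩
  obtain ⟨k, rfl⟩ := h234
  by_contra hne
  have h_lt := mul_sigma_one_lt_sigma_one_mul (a := 234) (k := k) (by norm_num) (by lia)
  have h_val : ArithmeticFunction.sigma 1 234 = 546 := by decide +kernel
  rw [h_val] at h_lt
  lia
end
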